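/- Let K ≥ 0 be an integer and u ∈ C^{K+2}(ℝ³;ℝ³) with bounded derivatives, ω = ∇×u. Fix C_0 = 0 and view Γ[u,C] as a function of the free vertices C_1,…,C_{N-1}. For every 2 ≤ k ≤ N−2, Migdal's discretized area derivative satisfies ( Σ_{j=k+1}^{N-1} ∇_{C_j} + (1/2) ∇_{C_k} ) × ∇_{C_k} Γ[u,C] = − ∫_0^1 ω( a C_k + (1−a)(C_{k-1}+C_{k+1})/2 ) da + R^k_{ad}, where |D^K_{C_k} R^k_{ad}| ≤ C(K) ‖D^{K+1} ω‖_{L^∞} |C_{k+1} − C_{k-1}| with C(K) depending only on K. -/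

import Mathlib

noncomputable section

open scoped RealInnerProductSpace BigOperators
open MeasureTheory

/-- ℝ³ as a Euclidean space. -/
abbrev E3 : Type := EuclideanSpace ℝ (Fin 3)

/-- The vector of `E3` with the three given coordinates. -/
def vec3 (a b c : ℝ) : E3 := (WithLp.equiv 2 (Fin 3 → ℝ)).symm ![a, b, c]

/-- Cross product on `E3`. -/
def cross3 (v w : E3) : E3 :=
  vec3 (v 1 * w 2 - v 2 * w 1) (v 2 * w 0 - v 0 * w 2) (v 0 * w 1 - v 1 * w 0)

/-- `j`-th standard basis vector of `E3`. -/
def e3 (j : Fin 3) : E3 := EuclideanSpace.single j 1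

/-- Curl (vorticity) of a vector field on `E3`. -/
def curl3 (u : E3 → E3) (x : E3) : E3 :=
  vec3 (fderiv ℝ u x (e3 1) 2 - fderiv ℝ u x (e3 2) 1)
       (fderiv ℝ u x (e3 2) 0 - fderiv ℝ u x (e3 0) 2)
       (fderiv ℝ u x (e3 0) 1 - fderiv ℝ u x (e3 1) 0)

/-- Divergence of a vector field on `E3`. -/
def div3 (u : E3 → E3) (x : E3) : ℝ := ∑ j : Fin 3, fderiv ℝ u x (e3 j) j

/-- Componentwise Laplacian of a vector field on `E3`. -/
def lap3 (u : E3 → E3) (x : E3) : E3 :=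
  ∑ j : Fin 3, fderiv ℝ (fun y => fderiv ℝ u y (e3 j)) x (e3 j)

/-- Transposed Jacobian of `ω` at `x`, applied to `v`:  `((Dω)ᵀ v)_j = ∑_i ∂_j ω_i v_i`. -/
def jacT (ω : E3 → E3) (x v : E3) : E3 :=
  (WithLp.equiv 2 (Fin 3 → ℝ)).symm fun j => ⟪fderiv ℝ ω x (e3 j), v⟫

/-- Sup norm of the `j`-th derivative of a vector field. -/
def supDeriv (j : ℕ) (u : E3 → E3) : ℝ := ⨆ x : E3, ‖iteratedFDeriv ℝ j u x‖

/-- `C^m` norm: maximum of the sup norms of the derivatives of order `≤ m`. -/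
def cNorm (m : ℕ) (u : E3 → E3) : ℝ :=
  (Finset.range (m + 1)).sup' (Finset.nonempty_range_iff.mpr (Nat.succ_ne_zero m))
    fun j => supDeriv j u

/-- Sobolev `H^K` norm. -/
def sobNorm (K : ℕ) (u : E3 → E3) : ℝ :=
  Real.sqrt (∑ j ∈ Finset.range (K + 1), ∫ x : E3, ‖iteratedFDeriv ℝ j u x‖ ^ 2)

/-- Circulation of `u` along the closed polygon with vertices `C 0, …, C (N-1)`. -/
def circulation (N : ℕ) [NeZero N] (u : E3 → E3) (C : Fin N → E3) : ℝ :=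
  ∑ k : Fin N, ∫ a in (0:ℝ)..(1:ℝ), ⟪u ((1 - a) • C k + a • C (k + 1)), C (k + 1) - C k⟫

/-- `⟨ω⟩` : average of `ω` along the segment joining `(xm+xp)/2` to `y`. -/
def segAvg (ω : E3 → E3) (xm y xp : E3) : E3 :=
  ∫ a in (0:ℝ)..(1:ℝ), ω (a • y + (1 - a) • ((2:ℝ)⁻¹ • (xm + xp)))

variable {N : ℕ}

/-- Partial derivative of a real functional of the vertices with respect to
the `j`-th coordinate of the vertex `k`. -/
def vpdR (k : Fin N) (j : Fin 3) (F : (Fin N → E3) → ℝ) (C : Fin N → E3) : ℝ :=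
  fderiv ℝ (fun x => F (Function.update C k x)) (C k) (e3 j)

/-- Gradient of a real functional of the vertices with respect to the vertex `k`. -/
def vgradR (k : Fin N) (F : (Fin N → E3) → ℝ) (C : Fin N → E3) : E3 :=
  gradient (fun x => F (Function.update C k x)) (C k)

/-- `∇_{C_a} × ∇_{C_b}` applied to a real functional of the vertices. -/
def gradCross (a b : Fin N) (F : (Fin N → E3) → ℝ) (C : Fin N → E3) : E3 :=
  vec3 (vpdR a 1 (vpdR b 2 F) C - vpdR a 2 (vpdR b 1 F) C)
       (vpdR a 2 (vpdR b 0 F) C - vpdR a 0 (vpdR b 2 F) C)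
       (vpdR a 0 (vpdR b 1 F) C - vpdR a 1 (vpdR b 0 F) C)

/-- Migdal's area derivative `(∑_{j>k} ∇_{C_j} + ½ ∇_{C_k}) × ∇_{C_k}` on real functionals. -/
def gradCrossM (k : Fin N) (F : (Fin N → E3) → ℝ) (C : Fin N → E3) : E3 :=
  (∑ j ∈ Finset.univ.filter (fun j : Fin N => (k : ℕ) < (j : ℕ)), gradCross j k F C)
    + (2:ℝ)⁻¹ • gradCross k k F C

/-- Partial derivative of a complex functional of the vertices. -/
def vpd (k : Fin N) (j : Fin 3) (F : (Fin N → E3) → ℂ) (C : Fin N → E3) : ℂ :=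
  fderiv ℝ (fun x => F (Function.update C k x)) (C k) (e3 j)

/-- `∇_{C_a} × ∇_{C_b}` on complex functionals. -/
def opCross (a b : Fin N) (F : (Fin N → E3) → ℂ) (C : Fin N → E3) : Fin 3 → ℂ :=
  ![vpd a 1 (vpd b 2 F) C - vpd a 2 (vpd b 1 F) C,
    vpd a 2 (vpd b 0 F) C - vpd a 0 (vpd b 2 F) C,
    vpd a 0 (vpd b 1 F) C - vpd a 1 (vpd b 0 F) C]

/-- `∇_{C_k} ×` applied to a `ℂ³`-valued functional of the vertices. -/
def vcurl (k : Fin N) (G : (Fin N → E3) → Fin 3 → ℂ) (C : Fin N → E3) : Fin 3 → ℂ :=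
  ![vpd k 1 (fun D => G D 2) C - vpd k 2 (fun D => G D 1) C,
    vpd k 2 (fun D => G D 0) C - vpd k 0 (fun D => G D 2) C,
    vpd k 0 (fun D => G D 1) C - vpd k 1 (fun D => G D 0) C]

/-- Embedding of a real vector into `ℂ³`. -/
def toC3 (v : E3) : Fin 3 → ℂ := fun j => (v j : ℂ)

/-- Bilinear (non-hermitian) dot product on `ℂ³`. -/
def cdot (v w : Fin 3 → ℂ) : ℂ := ∑ j : Fin 3, v j * w j

/-- Bilinear cross product on `ℂ³`. -/
def ccross3 (v w : Fin 3 → ℂ) : Fin 3 → ℂ :=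
  ![v 1 * w 2 - v 2 * w 1, v 2 * w 0 - v 0 * w 2, v 0 * w 1 - v 1 * w 0]

/-- Euclidean magnitude of a vector of `ℂ³`. -/
def cnorm3 (v : Fin 3 → ℂ) : ℝ := Real.sqrt (∑ j : Fin 3, Complex.normSq (v j))

/-- Pairing of a real vector with a complex vector. -/
def dotRC (v : E3) (w : Fin 3 → ℂ) : ℂ := ∑ j : Fin 3, (v j : ℂ) * w j

/-- A smooth cut-off `χ` which is `1` on `B_1(0)` and vanishes outside `B_2(0)`. -/
def IsCutoff (χ : E3 → ℝ) : Prop :=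
  ContDiff ℝ ((⊤ : ℕ∞) : WithTop ℕ∞) χ ∧ (∀ x : E3, ‖x‖ ≤ 1 → χ x = 1) ∧ (∀ x : E3, 2 ≤ ‖x‖ → χ x = 0)

/-- Kernel of the regularized Biot–Savart operator: `∇_y (χ(ℓ(x−y))/|x−y|)`. -/
def BSker (χ : E3 → ℝ) (ℓ : ℝ) (x y : E3) : E3 :=
  gradient (fun z => χ (ℓ • (x - z)) / ‖x - z‖) y

/-- Regularized Biot–Savart operator `BS_ℓ`. -/
def BSreg (χ : E3 → ℝ) (ℓ : ℝ) (ω : E3 → E3) (x : E3) : E3 :=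
  (4 * Real.pi)⁻¹ • ∫ y : E3, cross3 (ω y) (BSker χ ℓ x y)

/-- Regularized Biot–Savart operator on `ℂ³`-valued fields (componentwise). -/
def BSregC (χ : E3 → ℝ) (ℓ : ℝ) (ω : E3 → Fin 3 → ℂ) (x : E3) : Fin 3 → ℂ :=
  (4 * Real.pi)⁻¹ • ∫ y : E3, ccross3 (ω y) (toC3 (BSker χ ℓ x y))

/-- The discretized vorticity operator `Ω_k = (iν/γ) ∇_{C_{k+1}} × ∇_{C_k}`. -/
def vortOp [NeZero N] (γ ν : ℝ) (k : Fin N) (F : (Fin N → E3) → ℂ) (C : Fin N → E3) :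
    Fin 3 → ℂ :=
  (Complex.I * ν / γ) • opCross (k + 1) k F C

/-- The discretized diffusion operator `𝒟_k = 2 ∇_{C_k} × Ω_k`. -/
def diffOp [NeZero N] (γ ν : ℝ) (k : Fin N) (F : (Fin N → E3) → ℂ) (C : Fin N → E3) :
    Fin 3 → ℂ :=
  (2:ℂ) • vcurl k (vortOp γ ν k F) C

/-- The discretized velocity operator `U_k = (1/log(1/ρ)) BS_ℓ ∘ Ω_k`,
with `BS_ℓ` acting in the variable `C_k`. -/
def velOp [NeZero N] (χ : E3 → ℝ) (ℓ ρ γ ν : ℝ) (k : Fin N) (F : (Fin N → E3) → ℂ)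
    (C : Fin N → E3) : Fin 3 → ℂ :=
  (Real.log (1 / ρ))⁻¹ • BSregC χ ℓ (fun x => vortOp γ ν k F (Function.update C k x)) (C k)

/-- Levi-Civita symbol on `Fin 3`. -/
def levi3 (a b c : Fin 3) : ℝ :=
  if (a, b, c) = (0, 1, 2) ∨ (a, b, c) = (1, 2, 0) ∨ (a, b, c) = (2, 0, 1) then 1
  else if (a, b, c) = (2, 1, 0) ∨ (a, b, c) = (1, 0, 2) ∨ (a, b, c) = (0, 2, 1) then -1
  else 0

/-- The discretized advection operator `(Ω_{k+3} × U_k)_α = ε_{αij} Ω^i_{k+3} ∘ U^j_k`. -/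
def advecOp [NeZero N] (χ : E3 → ℝ) (ℓ ρ γ ν : ℝ) (k : Fin N) (F : (Fin N → E3) → ℂ)
    (C : Fin N → E3) : Fin 3 → ℂ :=
  fun α => ∑ i : Fin 3, ∑ j : Fin 3,
    (levi3 α i j : ℂ) * vortOp γ ν (k + 3) (fun D => velOp χ ℓ ρ γ ν k F D j) C i

/-- Migdal's discretized vorticity operator
`Ω^M_k = (iν/γ)(∑_{j=k+1}^{N-1} ∇_{C_j} + ½∇_{C_k}) × ∇_{C_k}`. -/
def vortOpM [NeZero N] (γ ν : ℝ) (k : Fin N) (F : (Fin N → E3) → ℂ) (C : Fin N → E3) :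
    Fin 3 → ℂ :=
  (Complex.I * ν / γ) •
    ((∑ j ∈ Finset.univ.filter (fun j : Fin N => (k : ℕ) < (j : ℕ)), opCross j k F C)
      + (2:ℂ)⁻¹ • opCross k k F C)

/-- Migdal's discretized diffusion operator `𝒟^M_k = 2 ∇_{C_k} × Ω^M_k`. -/
def diffOpM [NeZero N] (γ ν : ℝ) (k : Fin N) (F : (Fin N → E3) → ℂ) (C : Fin N → E3) :
    Fin 3 → ℂ :=
  (2:ℂ) • vcurl k (vortOpM γ ν k F) C

/-- Migdal's discretized velocity operator `U^M_k = (1/log(1/ρ)) BS_ℓ ∘ Ω^M_k`. -/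
def velOpM [NeZero N] (χ : E3 → ℝ) (ℓ ρ γ ν : ℝ) (k : Fin N) (F : (Fin N → E3) → ℂ)
    (C : Fin N → E3) : Fin 3 → ℂ :=
  (Real.log (1 / ρ))⁻¹ • BSregC χ ℓ (fun x => vortOpM γ ν k F (Function.update C k x)) (C k)

/-- The loop functional `Ψ[u,C] = exp((iγ/ν) Γ[u,C])` as a function of the vertices. -/
def loopExp (γ ν : ℝ) (N : ℕ) [NeZero N] (u : E3 → E3) (C : Fin N → E3) : ℂ :=
  Complex.exp (Complex.I * γ / ν * (circulation N u C : ℂ))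

/-- The momentum loop functional `Ψ[P,C](t) = exp((iγ/ν) ∑_k P_k(t)·ΔC_k)`. -/
def momFun (γ ν : ℝ) (N : ℕ) [NeZero N] (P : Fin N → ℝ → Fin 3 → ℂ) (t : ℝ)
    (C : Fin N → E3) : ℂ :=
  Complex.exp (Complex.I * γ / ν * ∑ k : Fin N, cdot (P k t) (toC3 (C (k + 1) - C k)))

/-- The expression `E_k` of the discretized momentum loop equation, as a function of
`ΔP_{k-1}, ΔP_k, ΔP_{k+2}, ΔP_{k+3}` (and of `log N`). -/
def EkDef (γ ν NR : ℝ) (dPm dP dP2 dP3 : Fin 3 → ℂ) : Fin 3 → ℂ :=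
  ((Real.log NR)⁻¹ : ℂ) •
      ((Complex.I * γ / ν) •
        ccross3 (ccross3 dP3 dP2) (dP - (cdot dPm dP / cdot dPm dPm) • dPm))
    + ((2 * γ ^ 2 / ν : ℝ) : ℂ) • (cdot dPm dPm • dP - cdot dPm dP • dPm)

theorem contDiff_partial_fderiv {H F : Type} [NormedAddCommGroup H] [NormedSpace ℝ H]
    [NormedAddCommGroup F] [NormedSpace ℝ F] {n : ℕ} {φ : H → ℝ → F}
    (hφ : ContDiff ℝ (n + 1 : ℕ) (Function.uncurry φ)) :
    ContDiff ℝ n (Function.uncurry fun x a => fderiv ℝ (fun y => φ y a) x) := by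
  have h : ContDiff ℝ (n + 1 : ℕ) (Function.uncurry fun (p : H × ℝ) (y : H) => φ y p.2) :=
    hφ.comp (contDiff_snd.prodMk (contDiff_snd.comp contDiff_fst))
  exact h.fderiv contDiff_fst (by norm_cast)

theorem hasFDerivAt_parametric_intervalIntegral {H F : Type} [NormedAddCommGroup H]
    [NormedSpace ℝ H] [FiniteDimensional ℝ H] [NormedAddCommGroup F] [NormedSpace ℝ F]
    {φ : H → ℝ → F} (hφ : ContDiff ℝ 1 (Function.uncurry φ)) (a₀ b₀ : ℝ) (x : H) :
    HasFDerivAt (fun y => ∫ a in a₀..b₀, φ y a)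
      (∫ a in a₀..b₀, fderiv ℝ (fun y => φ y a) x) x := by
  have hc : Continuous (Function.uncurry fun x a => fderiv ℝ (fun y => φ y a) x) :=
    (contDiff_partial_fderiv (n := 0) (by exact_mod_cast hφ)).continuous
  have hs : ∀ y, Continuous (φ y) := fun y =>
    hφ.continuous.comp (by fun_prop : Continuous fun a : ℝ => (y, a))
  have : ProperSpace H := FiniteDimensional.proper ℝ H
  obtain ⟨M, hM⟩ := ((isCompact_closedBall x 1).prod (isCompact_uIcc (a := a₀) (b := b₀)))
    |>.exists_bound_of_continuousOn hc.continuousOn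
  refine intervalIntegral.hasFDerivAt_integral_of_dominated_of_fderiv_le
    (F' := fun x a => fderiv ℝ (fun y => φ y a) x) (bound := fun _ => M)
    (Metric.closedBall_mem_nhds x one_pos)
    (Filter.Eventually.of_forall fun y => (hs y).aestronglyMeasurable)
    ((hs x).intervalIntegrable _ _)
    (Continuous.aestronglyMeasurable (hc.comp (by fun_prop : Continuous fun a : ℝ => (x, a))))
    (.of_forall fun a ha y hy => hM (y, a) ⟨hy, Set.uIoc_subset_uIcc ha⟩)
    (by simp) (.of_forall fun a _ y _ => ?_)
  have : ContDiff ℝ 1 fun y => φ y a := hφ.comp (contDiff_id.prodMk contDiff_const)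
  exact (this.differentiable (by norm_num) y).hasFDerivAt

theorem contDiff_parametric_intervalIntegral {H : Type} [NormedAddCommGroup H]
    [NormedSpace ℝ H] [FiniteDimensional ℝ H] (a₀ b₀ : ℝ) (n : ℕ) :
    ∀ {F : Type} [NormedAddCommGroup F] [NormedSpace ℝ F] {φ : H → ℝ → F},
      ContDiff ℝ n (Function.uncurry φ) →
        ContDiff ℝ n fun y => ∫ a in a₀..b₀, φ y a := by
  induction n with
  | zero =>
    intro F _ _ φ hφ
    have := hφ.continuous
    exact contDiff_zero.2
      (intervalIntegral.continuous_parametric_intervalIntegral_of_continuous' this a₀ b₀)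
  | succ n ih =>
    intro F _ _ φ hφ
    have h1 : ContDiff ℝ 1 (Function.uncurry φ) := hφ.of_le (by norm_cast; omega)
    rw [Nat.cast_succ, contDiff_succ_iff_hasFDerivAt]
    refine ⟨_, ih (contDiff_partial_fderiv hφ), ?_⟩
    exact fun x => hasFDerivAt_parametric_intervalIntegral h1 a₀ b₀ x

theorem fderiv_parametric_intervalIntegral_apply {H F : Type} [NormedAddCommGroup H]
    [NormedSpace ℝ H] [FiniteDimensional ℝ H] [NormedAddCommGroup F] [NormedSpace ℝ F]
    [CompleteSpace F]
    {φ : H → ℝ → F} (hφ : ContDiff ℝ 1 (Function.uncurry φ)) (a₀ b₀ : ℝ) (x e : H) :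
    fderiv ℝ (fun y => ∫ a in a₀..b₀, φ y a) x e
      = ∫ a in a₀..b₀, fderiv ℝ (fun y => φ y a) x e := by
  rw [(hasFDerivAt_parametric_intervalIntegral hφ a₀ b₀ x).fderiv]
  refine ContinuousLinearMap.intervalIntegral_apply (Continuous.intervalIntegrable ?_ _ _) e
  exact (contDiff_partial_fderiv (n := 0) (by exact_mod_cast hφ)).continuous.comp
    (by fun_prop : Continuous fun a : ℝ => (x, a))

/-- The Taylor-type remainder comparing weighted averages of `f` over the segments
from `m` to `x` and from `z` to `x`. -/
theorem norm_iteratedFDeriv_segment_average_sub_le {H : Type} [NormedAddCommGroup H]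
    [NormedSpace ℝ H] [FiniteDimensional ℝ H] (m z : H) {M : ℝ} (n : ℕ) :
    ∀ {F : Type} [NormedAddCommGroup F] [NormedSpace ℝ F] (f : H → F) (j : ℕ),
      ContDiff ℝ (n + 1 : ℕ) f → (∀ x, ‖iteratedFDeriv ℝ (n + 1) f x‖ ≤ M) → ∀ x,
        ‖iteratedFDeriv ℝ n (fun y => ∫ a in (0:ℝ)..1,
            a ^ j • (f (a • y + (1 - a) • m) - f (a • y + (1 - a) • z))) x‖
          ≤ M * ‖m - z‖ := by
  induction n with
  | zero =>
    intro F _ _ f j hf hM x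
    have hM0 : 0 ≤ M := (norm_nonneg _).trans (hM 0)
    have hM' : ∀ y, ‖fderiv ℝ f y‖ ≤ M := fun y => by
      have := hM y
      rwa [← norm_iteratedFDeriv_fderiv, norm_iteratedFDeriv_zero] at this
    rw [norm_iteratedFDeriv_zero]
    have : ∀ a ∈ Set.uIoc (0:ℝ) 1,
        ‖a ^ j • (f (a • x + (1 - a) • m) - f (a • x + (1 - a) • z))‖ ≤ M * ‖m - z‖ := by
      intro a ha
      rw [Set.uIoc_of_le zero_le_one] at ha
      obtain ⟨h0, h1⟩ := ha
      have hd := Convex.norm_image_sub_le_of_norm_fderiv_le (𝕜 := ℝ) (f := f) (C := M)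
        (s := Set.univ) (x := a • x + (1 - a) • z) (y := a • x + (1 - a) • m)
        (fun y _ => hf.differentiable (by norm_num) y) (fun y _ => hM' y) convex_univ trivial trivial
      rw [add_sub_add_left_eq_sub, ← smul_sub, norm_smul, Real.norm_of_nonneg (by linarith)] at hd
      rw [norm_smul, norm_pow, Real.norm_of_nonneg h0.le]
      have hz := norm_nonneg (m - z)
      calc a ^ j * ‖f (a • x + (1 - a) • m) - f (a • x + (1 - a) • z)‖
          ≤ 1 * (M * ((1 - a) * ‖m - z‖)) := by
            gcongr
            exact pow_le_one₀ h0.le h1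
        _ ≤ M * ‖m - z‖ := by
            rw [one_mul]
            gcongr
            nlinarith
    simpa using intervalIntegral.norm_integral_le_of_norm_le_const this
  | succ n ih =>
    intro F _ _ f j hf hM x
    have hφ : ContDiff ℝ 1 (Function.uncurry fun (y : H) (a : ℝ) =>
        a ^ j • (f (a • y + (1 - a) • m) - f (a • y + (1 - a) • z))) := by
      have hf1 : ContDiff ℝ 1 f := hf.of_le (by norm_cast; omega)
      unfold Function.uncurry
      fun_prop
    have hfd : Differentiable ℝ f := hf.differentiable (by norm_num)
    have hd : fderiv ℝ (fun y => ∫ a in (0:ℝ)..1,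
          a ^ j • (f (a • y + (1 - a) • m) - f (a • y + (1 - a) • z)))
        = fun y => ∫ a in (0:ℝ)..1, a ^ (j + 1) •
          (fderiv ℝ f (a • y + (1 - a) • m) - fderiv ℝ f (a • y + (1 - a) • z)) := by
      ext1 y
      rw [(hasFDerivAt_parametric_intervalIntegral hφ 0 1 y).fderiv]
      congr 1
      ext1 a
      have hp : ∀ q : H, HasFDerivAt (fun y : H => f (a • y + (1 - a) • q))
          (a • fderiv ℝ f (a • y + (1 - a) • q)) y := fun q => by
        have h := (hfd (a • y + (1 - a) • q)).hasFDerivAt.comp y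
          (((hasFDerivAt_id y).const_smul a).add_const ((1 - a) • q))
        refine h.congr_fderiv ?_
        ext e
        simp
      refine (((hp m).sub (hp z)).const_smul (a ^ j)).fderiv.trans ?_
      rw [← smul_sub, smul_smul, pow_succ]
    rw [← norm_iteratedFDeriv_fderiv, hd]
    refine ih (fderiv ℝ f) (j + 1) (hf.fderiv_right (by norm_cast)) (fun y => ?_) x
    rw [norm_iteratedFDeriv_fderiv]
    exact hM y

/-- Circulation of `u` along the segment from `y` to `z`. -/
def segCirc (u : E3 → E3) (y z : E3) : ℝ :=
  ∫ a in (0:ℝ)..1, ⟪u ((1 - a) • y + a • z), z - y⟫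

theorem contDiff_segCirc {u : E3 → E3} {n : ℕ} (hu : ContDiff ℝ n u) :
    ContDiff ℝ n (Function.uncurry (segCirc u)) := by
  refine contDiff_parametric_intervalIntegral 0 1 n
    (φ := fun (p : E3 × E3) (a : ℝ) => ⟪u ((1 - a) • p.1 + a • p.2), p.2 - p.1⟫) ?_
  exact ContDiff.inner ℝ (by fun_prop) (by fun_prop)

theorem fderiv_segCirc_left {u : E3 → E3} (hu : ContDiff ℝ 1 u) (y z e : E3) :
    fderiv ℝ (fun y => segCirc u y z) y e
      = ∫ a in (0:ℝ)..1, ((1 - a) * ⟪fderiv ℝ u ((1 - a) • y + a • z) e, z - y⟫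
          - ⟪u ((1 - a) • y + a • z), e⟫) := by
  have hφ : ContDiff ℝ 1 (Function.uncurry fun (y : E3) (a : ℝ) =>
      ⟪u ((1 - a) • y + a • z), z - y⟫) :=
    ContDiff.inner ℝ (by fun_prop) (by fun_prop)
  refine (fderiv_parametric_intervalIntegral_apply hφ 0 1 y e).trans ?_
  congr 1
  ext1 a
  have hp : HasFDerivAt (fun y : E3 => (1 - a) • y + a • z)
      ((1 - a) • ContinuousLinearMap.id ℝ E3) y :=
    ((hasFDerivAt_id y).const_smul (1 - a)).add_const (a • z)
  have h1 := (hu.differentiable (by norm_num) ((1 - a) • y + a • z)).hasFDerivAt.comp y hp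
  have h2 := (hasFDerivAt_id (𝕜 := ℝ) y).const_sub z
  have h := (h1.inner ℝ h2).fderiv
  refine (congrArg (fun L => L e) h).trans ?_
  simp [inner_neg_right, real_inner_smul_left]
  ring

theorem fderiv_fderiv_segCirc {u : E3 → E3} (hu : ContDiff ℝ 2 u) (y z e e' : E3) :
    fderiv ℝ (fun z => fderiv ℝ (fun y => segCirc u y z) y e) z e'
      = ∫ a in (0:ℝ)..1,
          (a * (1 - a) * ⟪fderiv ℝ (fderiv ℝ u) ((1 - a) • y + a • z) e' e, z - y⟫
          + (1 - a) * ⟪fderiv ℝ u ((1 - a) • y + a • z) e, e'⟫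
          - a * ⟪fderiv ℝ u ((1 - a) • y + a • z) e', e⟫) := by
  have hu1 : ContDiff ℝ 1 u := hu.of_le (by norm_num)
  have hdu : ContDiff ℝ 1 (fderiv ℝ u) := hu.fderiv_right (by norm_num)
  simp only [fderiv_segCirc_left hu1]
  have hφ : ContDiff ℝ 1 (Function.uncurry fun (z : E3) (a : ℝ) =>
      (1 - a) * ⟪fderiv ℝ u ((1 - a) • y + a • z) e, z - y⟫
          - ⟪u ((1 - a) • y + a • z), e⟫) :=
    ((contDiff_const.sub contDiff_snd).mul (ContDiff.inner ℝ (by fun_prop) (by fun_prop))).sub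
      (ContDiff.inner ℝ (by fun_prop) contDiff_const)
  refine (fderiv_parametric_intervalIntegral_apply hφ 0 1 z e').trans ?_
  congr 1
  ext1 a
  have hp : HasFDerivAt (fun z : E3 => (1 - a) • y + a • z)
      (a • ContinuousLinearMap.id ℝ E3) z :=
    ((hasFDerivAt_id z).const_smul a).const_add ((1 - a) • y)
  have h1 := (hu1.differentiable (by norm_num) ((1 - a) • y + a • z)).hasFDerivAt.comp z hp
  have h2 := ((hdu.differentiable (by norm_num)
    ((1 - a) • y + a • z)).hasFDerivAt.comp z hp).clm_apply (hasFDerivAt_const e z)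
  have h3 := (hasFDerivAt_id (𝕜 := ℝ) z).sub_const y
  have h := (((h2.inner ℝ h3).const_mul (1 - a)).sub (h1.inner ℝ (hasFDerivAt_const e z))).fderiv
  refine (congrArg (fun L => L e') h).trans ?_
  simp [real_inner_smul_left]
  ring

/-- The antisymmetrized mixed derivative of the circulation along a segment averages the
antisymmetrized Jacobian of `u` over the segment. -/
theorem fderiv_fderiv_segCirc_antisymm {u : E3 → E3} (hu : ContDiff ℝ 2 u) (y z e e' : E3) :
    fderiv ℝ (fun z => fderiv ℝ (fun y => segCirc u y z) y e) z e'
        - fderiv ℝ (fun z => fderiv ℝ (fun y => segCirc u y z) y e') z e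
      = -∫ a in (0:ℝ)..1, (⟪fderiv ℝ u ((1 - a) • y + a • z) e', e⟫
          - ⟪fderiv ℝ u ((1 - a) • y + a • z) e, e'⟫) := by
  have hu1 : ContDiff ℝ 1 u := hu.of_le (by norm_num)
  have hdu : ContDiff ℝ 1 (fderiv ℝ u) := hu.fderiv_right (by norm_num)
  have hdc : Continuous (fderiv ℝ u) := hdu.continuous
  have hddc : Continuous (fderiv ℝ (fderiv ℝ u)) := hdu.continuous_fderiv (by norm_num)
  rw [fderiv_fderiv_segCirc hu, fderiv_fderiv_segCirc hu, ← intervalIntegral.integral_sub,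
    ← intervalIntegral.integral_neg]
  · congr 1
    ext1 a
    have hs : fderiv ℝ (fderiv ℝ u) ((1 - a) • y + a • z) e' e
        = fderiv ℝ (fderiv ℝ u) ((1 - a) • y + a • z) e e' :=
      hu.contDiffAt.isSymmSndFDerivAt (by simp) e' e
    rw [hs]
    ring
  all_goals
    refine Continuous.intervalIntegrable ?_ _ _
    fun_prop

theorem circulation_update_eq [NeZero N] (u : E3 → E3) (C : Fin N → E3) (k : Fin N)
    (hk : k - 1 ≠ k) (hk' : k + 1 ≠ k) :
    ∃ c : ℝ, ∀ y, circulation N u (Function.update C k y)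
      = segCirc u (C (k - 1)) y + (segCirc u y (C (k + 1)) + c) := by
  refine ⟨∑ m ∈ (Finset.univ.erase (k - 1)).erase k, segCirc u (C m) (C (m + 1)), fun y => ?_⟩
  have h : circulation N u (Function.update C k y)
      = ∑ m, segCirc u (Function.update C k y m) (Function.update C k y (m + 1)) := rfl
  rw [h, ← Finset.add_sum_erase _ _ (Finset.mem_univ (k - 1)),
    ← Finset.add_sum_erase _ _ (Finset.mem_erase.2 ⟨hk.symm, Finset.mem_univ k⟩)]
  congr 1
  · simp [hk]
  congr 1
  · simp [hk']
  refine Finset.sum_congr rfl fun m hm => ?_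
  simp only [Finset.mem_erase] at hm
  have h1 : m + 1 ≠ k := fun h => hm.2.1 (by rw [← h, add_sub_cancel_right])
  rw [Function.update_of_ne hm.1, Function.update_of_ne h1]

theorem vpdR_circulation [NeZero N] {u : E3 → E3} (hu : ContDiff ℝ 1 u) (C : Fin N → E3)
    (k : Fin N) (hk : k - 1 ≠ k) (hk' : k + 1 ≠ k) (l : Fin 3) :
    vpdR k l (circulation N u) C
      = fderiv ℝ (fun y => segCirc u (C (k - 1)) y) (C k) (e3 l)
        + fderiv ℝ (fun y => segCirc u y (C (k + 1))) (C k) (e3 l) := by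
  obtain ⟨c, hc⟩ := circulation_update_eq u C k hk hk'
  have hL : Differentiable ℝ (Function.uncurry (segCirc u)) :=
    (contDiff_segCirc (n := 1) (by exact_mod_cast hu)).differentiable (by norm_num)
  have h1 : DifferentiableAt ℝ (fun y => segCirc u (C (k - 1)) y) (C k) :=
    hL.comp (by fun_prop : Differentiable ℝ fun y : E3 => (C (k - 1), y)) _
  have h2 : DifferentiableAt ℝ (fun y => segCirc u y (C (k + 1))) (C k) :=
    hL.comp (by fun_prop : Differentiable ℝ fun y : E3 => (y, C (k + 1))) _
  unfold vpdR
  simp only [hc]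
  rw [fderiv_fun_add h1 (h2.add_const c), fderiv_add_const]
  rfl

theorem vpdR_vpdR_self_comm {F : (Fin N → E3) → ℝ} {C : Fin N → E3} {k : Fin N}
    (hF : ContDiff ℝ 2 fun y => F (Function.update C k y)) (i l : Fin 3) :
    vpdR k i (vpdR k l F) C = vpdR k l (vpdR k i F) C := by
  have hd : Differentiable ℝ (fderiv ℝ fun y => F (Function.update C k y)) :=
    (hF.fderiv_right (m := 1) (by norm_num)).differentiable (by norm_num)
  have key : ∀ i l : Fin 3, vpdR k i (vpdR k l F) C
      = fderiv ℝ (fderiv ℝ fun y => F (Function.update C k y)) (C k) (e3 i) (e3 l) := by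
    intro i l
    unfold vpdR
    simp only [Function.update_idem, Function.update_self]
    rw [fderiv_clm_apply (hd _) (differentiableAt_const _)]
    simp
  rw [key, key]
  exact hF.contDiffAt.isSymmSndFDerivAt (by simp) _ _

theorem gradCross_self {F : (Fin N → E3) → ℝ} {C : Fin N → E3} {k : Fin N}
    (hF : ContDiff ℝ 2 fun y => F (Function.update C k y)) : gradCross k k F C = 0 := by
  unfold gradCross
  rw [vpdR_vpdR_self_comm hF 1 2, vpdR_vpdR_self_comm hF 2 0, vpdR_vpdR_self_comm hF 0 1]
  ext i
  fin_cases i <;> simp [vec3]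

theorem vpdR_vpdR_circulation_of_ne [NeZero N] {u : E3 → E3} (hu : ContDiff ℝ 1 u)
    (C : Fin N → E3) (j k : Fin N) (hk : k - 1 ≠ k) (hk' : k + 1 ≠ k) (hj : j ≠ k - 1)
    (hj' : j ≠ k) (hj'' : j ≠ k + 1) (i l : Fin 3) :
    vpdR j i (vpdR k l (circulation N u)) C = 0 := by
  rw [vpdR]
  simp only [vpdR_circulation hu _ k hk hk' l, Function.update_of_ne hj.symm,
    Function.update_of_ne hj'.symm, Function.update_of_ne hj''.symm]
  simp

theorem vpdR_succ_vpdR_circulation [NeZero N] {u : E3 → E3} (hu : ContDiff ℝ 1 u)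
    (C : Fin N → E3) (k : Fin N) (hk : k - 1 ≠ k) (hk' : k + 1 ≠ k) (hk'' : k - 1 ≠ k + 1)
    (i l : Fin 3) :
    vpdR (k + 1) i (vpdR k l (circulation N u)) C
      = fderiv ℝ (fun z => fderiv ℝ (fun y => segCirc u y z) (C k) (e3 l)) (C (k + 1)) (e3 i) := by
  rw [vpdR]
  simp only [vpdR_circulation hu _ k hk hk' l, Function.update_of_ne hk'',
    Function.update_of_ne hk'.symm, Function.update_self]
  rw [fderiv_const_add]

theorem inner_e3 (v : E3) (j : Fin 3) : ⟪v, e3 j⟫ = v j := by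
  simp [e3, EuclideanSpace.inner_single_right]

/-- The curl as a continuous linear function of the Jacobian. -/
def curlCLM : (E3 →L[ℝ] E3) →L[ℝ] E3 :=
  LinearMap.toContinuousLinearMap
    { toFun := fun A => vec3 (A (e3 1) 2 - A (e3 2) 1) (A (e3 2) 0 - A (e3 0) 2)
        (A (e3 0) 1 - A (e3 1) 0)
      map_add' := fun A B => by
        ext i
        fin_cases i <;> simp [vec3] <;> ring
      map_smul' := fun c A => by
        ext i
        fin_cases i <;> simp [vec3] <;> ring }

theorem curl3_eq_comp (u : E3 → E3) : curl3 u = curlCLM ∘ fderiv ℝ u := rfl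

theorem contDiff_curl3 {u : E3 → E3} {n : ℕ} (hu : ContDiff ℝ (n + 1 : ℕ) u) :
    ContDiff ℝ n (curl3 u) := by
  rw [curl3_eq_comp]
  exact curlCLM.contDiff.comp (hu.fderiv_right (by norm_cast))

theorem norm_iteratedFDeriv_curl3_le_supDeriv {u : E3 → E3} {n : ℕ}
    (hu : ContDiff ℝ (n + 1 : ℕ) u) (hb : ∃ M, ∀ x, ‖iteratedFDeriv ℝ (n + 1) u x‖ ≤ M) (x : E3) :
    ‖iteratedFDeriv ℝ n (curl3 u) x‖ ≤ supDeriv n (curl3 u) := by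
  obtain ⟨M, hM⟩ := hb
  refine le_ciSup (f := fun x => ‖iteratedFDeriv ℝ n (curl3 u) x‖)
    ⟨‖curlCLM‖ * M, ?_⟩ x
  rintro _ ⟨y, rfl⟩
  have hd : ContDiff ℝ n (fderiv ℝ u) := hu.fderiv_right (by norm_cast)
  have h := curlCLM.norm_iteratedFDeriv_comp_left (n := n) (x := y) hd.contDiffAt le_rfl
  rw [norm_iteratedFDeriv_fderiv] at h
  exact h.trans (by gcongr; exact hM y)

theorem gradCross_succ_circulation [NeZero N] {u : E3 → E3} (hu : ContDiff ℝ 2 u)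
    (C : Fin N → E3) (k : Fin N) (hk : k - 1 ≠ k) (hk' : k + 1 ≠ k) (hk'' : k - 1 ≠ k + 1) :
    gradCross (k + 1) k (circulation N u) C
      = -∫ a in (0:ℝ)..1, curl3 u ((1 - a) • C k + a • C (k + 1)) := by
  have hu1 : ContDiff ℝ 1 u := hu.of_le (by norm_num)
  have hint : IntervalIntegrable (fun a : ℝ => curl3 u ((1 - a) • C k + a • C (k + 1)))
      volume 0 1 :=
    ((contDiff_curl3 (n := 0) (by exact_mod_cast hu1)).continuous.comp (by fun_prop)).intervalIntegrable _ _
  have hcomp : ∀ i : Fin 3, (∫ a in (0:ℝ)..1, curl3 u ((1 - a) • C k + a • C (k + 1))) i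
      = ∫ a in (0:ℝ)..1, curl3 u ((1 - a) • C k + a • C (k + 1)) i := fun i =>
    ((EuclideanSpace.proj (𝕜 := ℝ) i).intervalIntegral_comp_comm hint).symm
  have hanti : ∀ i l : Fin 3, vpdR (k + 1) i (vpdR k l (circulation N u)) C
        - vpdR (k + 1) l (vpdR k i (circulation N u)) C
      = -∫ a in (0:ℝ)..1, (fderiv ℝ u ((1 - a) • C k + a • C (k + 1)) (e3 i) l
          - fderiv ℝ u ((1 - a) • C k + a • C (k + 1)) (e3 l) i) := fun i l => by
    rw [vpdR_succ_vpdR_circulation hu1 C k hk hk' hk'',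
      vpdR_succ_vpdR_circulation hu1 C k hk hk' hk'', fderiv_fderiv_segCirc_antisymm hu]
    simp only [inner_e3]
  unfold gradCross
  rw [hanti 1 2, hanti 2 0, hanti 0 1]
  ext i
  rw [PiLp.neg_apply, hcomp]
  fin_cases i <;> simp [vec3, curl3]

/-- Migdal's area derivative of the circulation is minus the average vorticity on the
edge leaving the vertex. -/
theorem gradCrossM_circulation [NeZero N] {u : E3 → E3} (hu : ContDiff ℝ 2 u)
    (C : Fin N → E3) (k : Fin N) (hk : 1 ≤ (k : ℕ)) (hk' : (k : ℕ) + 1 < N) :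
    gradCrossM k (circulation N u) C
      = -∫ a in (0:ℝ)..1, curl3 u ((1 - a) • C k + a • C (k + 1)) := by
  have hu1 : ContDiff ℝ 1 u := hu.of_le (by norm_num)
  have hone : ((1 : Fin N) : ℕ) = 1 := by
    rw [Fin.val_one', Nat.mod_eq_of_lt (by omega)]
  have hsucc : ((k + 1 : Fin N) : ℕ) = k + 1 := by
    rw [Fin.val_add, hone, Nat.mod_eq_of_lt hk']
  have hpred : ((k - 1 : Fin N) : ℕ) = k - 1 := by
    rw [Fin.sub_val_of_le (by rw [Fin.le_def, hone]; exact hk), hone]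
  have h1 : k - 1 ≠ k := by rw [Ne, Fin.ext_iff]; omega
  have h2 : k + 1 ≠ k := by rw [Ne, Fin.ext_iff]; omega
  have h3 : k - 1 ≠ k + 1 := by rw [Ne, Fin.ext_iff]; omega
  obtain ⟨c, hc⟩ := circulation_update_eq u C k h1 h2
  have hL : ContDiff ℝ 2 (Function.uncurry (segCirc u)) :=
    contDiff_segCirc (n := 2) (by exact_mod_cast hu)
  have hF : ContDiff ℝ 2 fun y => circulation N u (Function.update C k y) := by
    simp only [hc]
    exact (hL.comp (contDiff_const.prodMk contDiff_id)).add
      ((hL.comp (contDiff_id.prodMk contDiff_const)).add contDiff_const)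
  rw [gradCrossM, gradCross_self hF, smul_zero, add_zero,
    Finset.sum_eq_single_of_mem (k + 1) (Finset.mem_filter.2 ⟨Finset.mem_univ _, by omega⟩),
    gradCross_succ_circulation hu C k h1 h2 h3]
  intro j hj hjk
  rw [Finset.mem_filter] at hj
  have hz := vpdR_vpdR_circulation_of_ne hu1 C j k h1 h2
    (by rw [Ne, Fin.ext_iff]; omega) (by rw [Ne, Fin.ext_iff]; omega) hjk
  ext i
  fin_cases i <;> simp [gradCross, hz, vec3]

/-! ## Statement 10 -/
theorem stmt_10 (K : ℕ) :
    ∃ cK > (0:ℝ),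
      ∀ (N : ℕ) [NeZero N], 3 ≤ N →
      ∀ u : E3 → E3, ContDiff ℝ (K + 2 : ℕ) u →
        (∀ j ≤ K + 2, ∃ M, ∀ x, ‖iteratedFDeriv ℝ j u x‖ ≤ M) →
      ∀ C : Fin N → E3, C 0 = 0 →
      ∀ k : Fin N, 2 ≤ (k : ℕ) → (k : ℕ) ≤ N - 2 →
        ‖iteratedFDeriv ℝ K
            (fun x =>
              gradCrossM k (circulation N u) (Function.update C k x)
                + segAvg (curl3 u) (C (k - 1)) x (C (k + 1)))
            (C k)‖
          ≤ cK * supDeriv (K + 1) (curl3 u) * ‖C (k + 1) - C (k - 1)‖ := by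
  refine ⟨1, one_pos, fun N _ _ u hu hb C _ k hk hkN => ?_⟩
  have hu2 : ContDiff ℝ 2 u := hu.of_le (by norm_cast; omega)
  have hone : ((1 : Fin N) : ℕ) = 1 := by
    rw [Fin.val_one', Nat.mod_eq_of_lt (by omega)]
  have hsucc : ((k + 1 : Fin N) : ℕ) = k + 1 := by
    rw [Fin.val_add, hone, Nat.mod_eq_of_lt (by omega)]
  have h2 : k + 1 ≠ k := by rw [Ne, Fin.ext_iff]; omega
  have hω : ContDiff ℝ (K + 1 : ℕ) (curl3 u) := contDiff_curl3 hu
  have hωc : Continuous (curl3 u) := hω.continuous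
  set m : E3 := (2:ℝ)⁻¹ • (C (k - 1) + C (k + 1)) with hm
  have heq : (fun x => gradCrossM k (circulation N u) (Function.update C k x)
        + segAvg (curl3 u) (C (k - 1)) x (C (k + 1)))
      = fun x => ∫ a in (0:ℝ)..1, a ^ 0 •
        (curl3 u (a • x + (1 - a) • m) - curl3 u (a • x + (1 - a) • C (k + 1))) := by
    ext1 x
    have hflip : ∫ a in (0:ℝ)..1, curl3 u ((1 - a) • x + a • C (k + 1))
        = ∫ a in (0:ℝ)..1, curl3 u (a • x + (1 - a) • C (k + 1)) := by
      simpa using intervalIntegral.integral_comp_sub_left (a := 0) (b := 1)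
        (fun a : ℝ => curl3 u (a • x + (1 - a) • C (k + 1))) 1
    rw [gradCrossM_circulation hu2 _ k (by omega) (by omega), Function.update_self,
      Function.update_of_ne h2, hflip, segAvg, neg_add_eq_sub, ← intervalIntegral.integral_sub]
    · simp only [pow_zero, one_smul, hm]
    all_goals exact (hωc.comp (by fun_prop)).intervalIntegrable _ _
  have hsup := norm_iteratedFDeriv_curl3_le_supDeriv hu (hb (K + 2) le_rfl)
  have hS : 0 ≤ supDeriv (K + 1) (curl3 u) := (norm_nonneg _).trans (hsup 0)
  have hdist : ‖m - C (k + 1)‖ ≤ ‖C (k + 1) - C (k - 1)‖ := by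
    have : m - C (k + 1) = (-(2:ℝ)⁻¹) • (C (k + 1) - C (k - 1)) := by
      rw [hm]
      module
    rw [this, norm_smul]
    have := norm_nonneg (C (k + 1) - C (k - 1))
    norm_num
    linarith
  rw [heq, one_mul]
  exact (norm_iteratedFDeriv_segment_average_sub_le m (C (k + 1)) K (curl3 u) 0 hω hsup (C k)).trans
    (mul_le_mul_of_nonneg_left hdist hS)

end
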